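/- Suppose (X_i)_{i∈ℤ} is a strictly stationary sequence of ℝ^d-valued random vectors with continuous marginal c.d.f.s and Condition 4.1 holds with parameter θ₁. Then for every μ ∈ (0, θ₁): sup_{u ∈ [0,1]^d} | Ĉ_n(u) − C_n(u) | = o_P(n^{−1/2−μ}) as n → ∞, where Ĉ_n is the empirical copula and C_n(u) = G_n(G_{n1}^−(u_1),…,G_{nd}^−(u_d)). -/

import Mathlib

open MeasureTheory Filter Set
open scoped ENNReal NNReal

noncomputable section

namespace BBV

variable {Ω : Type*} [MeasurableSpace Ω] {E : Type*} [MeasurableSpace E] {d : ℕ}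

/-- The real-valued indicator function of a set. -/
def indic {α : Type*} (s : Set α) (x : α) : ℝ := s.indicator (fun _ => (1 : ℝ)) x

/-- `Z n = o_P(r n)`: convergence to zero in (outer) probability at rate `r`. -/
def oP (P : Measure Ω) (Z : ℕ → Ω → ℝ) (r : ℕ → ℝ) : Prop :=
  ∀ ε : ℝ, 0 < ε → Tendsto (fun n => P {ω | ε * r n < |Z n ω|}) atTop (nhds 0)

/-- `Z n = o_P(1)`: convergence to zero in (outer) probability. -/
def oP1 (P : Measure Ω) (Z : ℕ → Ω → ℝ) : Prop := oP P Z fun _ => 1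

/-- `Z n = O_P(1)`: boundedness in (outer) probability. -/
def bigOP (P : Measure Ω) (Z : ℕ → Ω → ℝ) : Prop :=
  ∀ ε : ℝ, 0 < ε → ∃ M : ℝ, ∀ᶠ n in atTop, P {ω | M < |Z n ω|} ≤ ENNReal.ofReal ε

/-- Strict stationarity of a two-sided sequence: all finite-dimensional distributions
are invariant under shifts. -/
def StrictlyStationary (P : Measure Ω) (X : ℤ → Ω → E) : Prop :=
  ∀ (m : ℕ) (idx : Fin m → ℤ) (k : ℤ),
    Measure.map (fun ω (p : Fin m) => X (idx p + k) ω) P =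
      Measure.map (fun ω (p : Fin m) => X (idx p) ω) P

/-- The sigma-field generated by the variables `X i`, `i ∈ S`. -/
def mixSigma (X : ℤ → Ω → E) (S : Set ℤ) : MeasurableSpace Ω :=
  ⨆ i ∈ S, MeasurableSpace.comap (X i) inferInstance

/-- The alpha-mixing coefficient of the sequence `X`. -/
def alphaMix (P : Measure Ω) (X : ℤ → Ω → E) (k : ℕ) : ℝ :=
  sSup {r : ℝ | ∃ (i : ℤ) (A B : Set Ω),
    MeasurableSet[mixSigma X (Set.Iic i)] A ∧
    MeasurableSet[mixSigma X (Set.Ici (i + (k : ℤ)))] B ∧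
    r = |(P (A ∩ B)).toReal - (P A).toReal * (P B).toReal|}

/-- Exponentially decaying alpha-mixing coefficients: `α(k) = O(a^k)` for some `a ∈ (0,1)`. -/
def ExpAlphaMixing (P : Measure Ω) (X : ℤ → Ω → E) : Prop :=
  ∃ a ∈ Set.Ioo (0 : ℝ) 1, ∃ c : ℝ, ∀ k : ℕ, 1 ≤ k → alphaMix P X k ≤ c * a ^ k

/-- Marginal c.d.f. `F_j` of the stationary sequence. -/
def margF (P : Measure Ω) (X : ℤ → Ω → Fin d → ℝ) (j : Fin d) (x : ℝ) : ℝ :=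
  (P {ω | X 0 ω j ≤ x}).toReal

/-- `U_i = (F_1(X_{i1}),…,F_d(X_{id}))`. -/
def Uv (P : Measure Ω) (X : ℤ → Ω → Fin d → ℝ) (i : ℤ) (ω : Ω) (j : Fin d) : ℝ :=
  margF P X j (X i ω j)

/-- The copula `C` of the stationary distribution, i.e. the c.d.f. of `U_0`. -/
def cop (P : Measure Ω) (X : ℤ → Ω → Fin d → ℝ) (u : Fin d → ℝ) : ℝ :=
  (P {ω | ∀ j, Uv P X 0 ω j ≤ u j}).toReal

/-- Empirical c.d.f. `G_n` of the (unobservable) sample `U_1,…,U_n`. -/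
def Gn (P : Measure Ω) (X : ℤ → Ω → Fin d → ℝ) (n : ℕ) (u : Fin d → ℝ) (ω : Ω) : ℝ :=
  (n : ℝ)⁻¹ * ∑ i ∈ Finset.Icc (1 : ℤ) (n : ℤ), indic {ω' | ∀ j, Uv P X i ω' j ≤ u j} ω

/-- The empirical process `α_n = √n (G_n − C)`. -/
def alphan (P : Measure Ω) (X : ℤ → Ω → Fin d → ℝ) (n : ℕ) (u : Fin d → ℝ) (ω : Ω) : ℝ :=
  Real.sqrt n * (Gn P X n u ω - cop P X u)

/-- Marginal empirical c.d.f. `G_{nj}` based on `U_{1j},…,U_{nj}`. -/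
def Gnj (P : Measure Ω) (X : ℤ → Ω → Fin d → ℝ) (n : ℕ) (j : Fin d) (s : ℝ) (ω : Ω) : ℝ :=
  (n : ℝ)⁻¹ * ∑ i ∈ Finset.Icc (1 : ℤ) (n : ℤ), indic {ω' | Uv P X i ω' j ≤ s} ω

/-- The marginal empirical process `α_{nj}(s) = √n (G_{nj}(s) − s)`. -/
def alphanj (P : Measure Ω) (X : ℤ → Ω → Fin d → ℝ) (n : ℕ) (j : Fin d) (s : ℝ) (ω : Ω) : ℝ :=
  Real.sqrt n * (Gnj P X n j s ω - s)

/-- Left-continuous generalized inverse: `H⁻(s) = inf{x : H(x) ≥ s}` for `s ≠ 0`,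
and `H⁻(0) = sup{x : H(x) = 0}`. -/
def genInv (H : ℝ → ℝ) (s : ℝ) : ℝ :=
  if s = 0 then sSup {x | H x = 0} else sInf {x | s ≤ H x}

/-- The marginal quantile process `β_{nj}(s) = √n (G_{nj}⁻(s) − s)`. -/
def betanj (P : Measure Ω) (X : ℤ → Ω → Fin d → ℝ) (n : ℕ) (j : Fin d) (s : ℝ) (ω : Ω) : ℝ :=
  Real.sqrt n * (genInv (fun x => Gnj P X n j x ω) s - s)

/-- Marginal empirical c.d.f. `F_{nj}` of the observations `X_{1j},…,X_{nj}`. -/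
def empCdfX (X : ℤ → Ω → Fin d → ℝ) (n : ℕ) (j : Fin d) (x : ℝ) (ω : Ω) : ℝ :=
  (n : ℝ)⁻¹ * ∑ i ∈ Finset.Icc (1 : ℤ) (n : ℤ), indic {ω' | X i ω' j ≤ x} ω

/-- Pseudo-observations `Û_{ij} = n/(n+1) · F_{nj}(X_{ij})`. -/
def pseudoObs (X : ℤ → Ω → Fin d → ℝ) (n : ℕ) (i : ℤ) (ω : Ω) (j : Fin d) : ℝ :=
  (n : ℝ) / ((n : ℝ) + 1) * empCdfX X n j (X i ω j) ω

/-- The empirical copula `Ĉ_n`. -/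
def empCop (X : ℤ → Ω → Fin d → ℝ) (n : ℕ) (u : Fin d → ℝ) (ω : Ω) : ℝ :=
  (n : ℝ)⁻¹ * ∑ i ∈ Finset.Icc (1 : ℤ) (n : ℤ), indic {ω' | ∀ j, pseudoObs X n i ω' j ≤ u j} ω

/-- The empirical copula process `ĈP_n = √n (Ĉ_n − C)`. -/
def hatCP (P : Measure Ω) (X : ℤ → Ω → Fin d → ℝ) (n : ℕ) (u : Fin d → ℝ) (ω : Ω) : ℝ :=
  Real.sqrt n * (empCop X n u ω - cop P X u)

/-- First-order partial derivative `Ċ_j` of `C`, defined everywhere as the limsup of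
difference quotients (which coincides with the partial derivative wherever it exists). -/
def Cdot (C : (Fin d → ℝ) → ℝ) (j : Fin d) (u : Fin d → ℝ) : ℝ :=
  Filter.limsup (fun h : ℝ => (C (Function.update u j (u j + h)) - C u) / h)
    (nhdsWithin 0 {(0 : ℝ)}ᶜ)

/-- The process `C̄_n(u) = α_n(u) − Σ_j Ċ_j(u) α_n(u^{(j)})`. -/
def Cbar (P : Measure Ω) (X : ℤ → Ω → Fin d → ℝ) (n : ℕ) (u : Fin d → ℝ) (ω : Ω) : ℝ :=
  alphan P X n u ω -
    ∑ j, Cdot (cop P X) j u * alphan P X n (Function.update (fun _ => (1 : ℝ)) j (u j)) ω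

/-- `C_n(u) = G_n(G_{n1}⁻(u₁),…,G_{nd}⁻(u_d))`. -/
def copGI (P : Measure Ω) (X : ℤ → Ω → Fin d → ℝ) (n : ℕ) (u : Fin d → ℝ) (ω : Ω) : ℝ :=
  Gn P X n (fun j => genInv (fun x => Gnj P X n j x ω) (u j)) ω

/-- The empirical copula process `𝔺_n = √n (C_n − C)` based on generalized inverses. -/
def CPgi (P : Measure Ω) (X : ℤ → Ω → Fin d → ℝ) (n : ℕ) (u : Fin d → ℝ) (ω : Ω) : ℝ :=
  Real.sqrt n * (copGI P X n u ω - cop P X u)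

/-- `g₁(u) = min{ min_j u_j , min_j [1 − min_{k ≠ j} u_k] }`. -/
def g1 (u : Fin d → ℝ) : ℝ :=
  min (⨅ j, u j) (⨅ j : Fin d, (1 - ⨅ k : {k : Fin d // k ≠ j}, u (k : Fin d)))

/-- The weight function `g_ω(u) = g₁(u)^ω`. -/
def gW (w : ℝ) (u : Fin d → ℝ) : ℝ := g1 u ^ w

/-- `g̃_ω(u) = g_ω(u) + 1{g_ω(u) = 0}`. -/
def gTilde (w : ℝ) (u : Fin d → ℝ) : ℝ := if gW w u = 0 then 1 else gW w u

/-- `N(a,b) = {u ∈ [0,1]^d : a < g₁(u) ≤ b}`. -/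
def NN (d : ℕ) (a b : ℝ) : Set (Fin d → ℝ) :=
  {u | (∀ j, 0 ≤ u j ∧ u j ≤ 1) ∧ a < g1 u ∧ g1 u ≤ b}

/-- `V_j = {u ∈ [0,1]^d : u_j ∈ (0,1)}`. -/
def VV (d : ℕ) (j : Fin d) : Set (Fin d → ℝ) :=
  {u | (∀ k, 0 ≤ u k ∧ u k ≤ 1) ∧ 0 < u j ∧ u j < 1}

/-- Condition 2.1: existence, continuity and growth bounds for the first and second
order partial derivatives of the copula `C`. -/
def Condition21 (C : (Fin d → ℝ) → ℝ) : Prop :=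
  (∀ j : Fin d, ∀ u ∈ VV d j,
    HasDerivAt (fun t => C (Function.update u j t)) (Cdot C j u) (u j)) ∧
  (∀ j : Fin d, ContinuousOn (Cdot C j) (VV d j)) ∧
  ∃ Cdd : Fin d → Fin d → (Fin d → ℝ) → ℝ,
    (∀ j₁ j₂ : Fin d, ∀ u ∈ VV d j₁ ∩ VV d j₂,
      HasDerivAt (fun t => Cdot C j₂ (Function.update u j₁ t)) (Cdd j₁ j₂ u) (u j₁)) ∧
    (∀ j₁ j₂ : Fin d, ContinuousOn (Cdd j₁ j₂) (VV d j₁ ∩ VV d j₂)) ∧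
    ∃ K : ℝ, 0 < K ∧ ∀ j₁ j₂ : Fin d, ∀ u ∈ VV d j₁ ∩ VV d j₂,
      |Cdd j₁ j₂ u| ≤ K * min (1 / (u j₁ * (1 - u j₁))) (1 / (u j₂ * (1 - u j₂)))

/-- The weighted modulus of continuity `M_n(δ,μ)` of the empirical process. -/
def Mn (P : Measure Ω) (X : ℤ → Ω → Fin d → ℝ) (n : ℕ) (δ μ : ℝ) (ω : Ω) : ℝ :=
  ⨆ q ∈ {q : (Fin d → ℝ) × (Fin d → ℝ) |
      q.1 ∈ Set.Icc 0 1 ∧ q.2 ∈ Set.Icc 0 1 ∧ dist q.1 q.2 ≤ δ},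
    |alphan P X n q.1 ω - alphan P X n q.2 ω| / max (dist q.1 q.2 ^ μ) ((n : ℝ) ^ (-μ))

/-- Condition 4.1 with parameter `θ₁`. -/
def Condition41 (P : Measure Ω) (X : ℤ → Ω → Fin d → ℝ) (θ₁ : ℝ) : Prop :=
  ∀ μ ∈ Set.Ioo (0 : ℝ) θ₁, ∀ δ : ℕ → ℝ, Tendsto δ atTop (nhds 0) →
    oP1 P (fun n ω => Mn P X n (δ n) μ ω)

/-- Condition 4.3 with parameters `θ₂, θ₃`. -/
def Condition43 (P : Measure Ω) (X : ℤ → Ω → Fin d → ℝ) (θ₂ θ₃ : ℝ) : Prop :=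
  ∀ w ∈ Set.Ioo (0 : ℝ) θ₂, ∀ lam ∈ Set.Ioo (0 : ℝ) θ₃, ∀ j : Fin d,
    bigOP P (fun n ω => ⨆ s ∈ Set.Ioo (0 : ℝ) 1,
      |alphanj P X n j s ω| / (s * (1 - s)) ^ w) ∧
    bigOP P (fun n ω => ⨆ s ∈ Set.Ioo ((n : ℝ) ^ (-lam)) (1 - (n : ℝ) ^ (-lam)),
      |betanj P X n j s ω| / (s * (1 - s)) ^ w)

open scoped Classical in
theorem indic_setOf {α : Type*} (p : α → Prop) (x : α) :
    indic {y | p y} x = if p x then 1 else 0 := by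
  simp [indic, Set.indicator_apply]

theorem abs_indic_forall_sub_indic_forall_le {ι α : Type*} [Fintype ι] {p q r : ι → α → Prop}
    {x : α} (h : ∀ j, ¬(p j x ↔ q j x) → r j x) :
    |indic {y | ∀ j, p j y} x - indic {y | ∀ j, q j y} x| ≤ ∑ j, indic {y | r j y} x := by
  classical
  have h0 : ∀ j, 0 ≤ indic {y | r j y} x := fun j => by
    rw [indic_setOf]; split_ifs <;> norm_num
  by_cases hall : ∀ j, p j x ↔ q j x
  · refine le_of_eq_of_le ?_ (Finset.sum_nonneg fun j _ => h0 j)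
    simp only [indic_setOf]
    split_ifs <;> simp_all
  · push Not at hall
    obtain ⟨j, hj⟩ := hall
    have hr : r j x := h j (by tauto)
    have h1 : indic {y | r j y} x ≤ ∑ j, indic {y | r j y} x :=
      Finset.single_le_sum (f := fun j => indic {y | r j y} x) (fun j _ => h0 j)
        (Finset.mem_univ j)
    refine le_trans ?_ h1
    simp only [indic_setOf, hr, if_true]
    split_ifs <;> norm_num

section Marginal

variable (P : Measure Ω) (X : ℤ → Ω → Fin d → ℝ)

theorem margF_eq_cdf [IsProbabilityMeasure P] (hmeas : Measurable (X 0)) (j : Fin d) :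
    margF P X j = ProbabilityTheory.cdf (P.map fun ω => X 0 ω j) := by
  have hm : Measurable fun ω => X 0 ω j := (measurable_pi_apply j).comp hmeas
  have := Measure.isProbabilityMeasure_map (μ := P) hm.aemeasurable
  ext x
  rw [ProbabilityTheory.cdf_eq_real, Measure.real, Measure.map_apply hm measurableSet_Iic]
  rfl

theorem margF_mono [IsProbabilityMeasure P] (j : Fin d) : Monotone (margF P X j) := fun _ _ hxy =>
  ENNReal.toReal_mono (measure_ne_top _ _) (measure_mono fun _ hω => le_trans hω hxy)

theorem Uv_nonneg (i : ℤ) (ω : Ω) (j : Fin d) : 0 ≤ Uv P X i ω j := ENNReal.toReal_nonneg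

theorem Uv_le_one [IsProbabilityMeasure P] (i : ℤ) (ω : Ω) (j : Fin d) : Uv P X i ω j ≤ 1 :=
  measureReal_le_one

/-- `F(X)` is stochastically at least as large as a uniform variable. -/
theorem measure_Uv_le_le [IsProbabilityMeasure P] (hmeas : Measurable (X 0)) (j : Fin d)
    (hc : Continuous (margF P X j))
    {s : ℝ} (hs : 0 ≤ s) : (P {ω | Uv P X 0 ω j ≤ s}).toReal ≤ s := by
  rcases le_or_gt 1 s with h1 | h1
  · exact le_trans measureReal_le_one h1
  have hm : Measurable fun ω => X 0 ω j := (measurable_pi_apply j).comp hmeas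
  have := Measure.isProbabilityMeasure_map (μ := P) hm.aemeasurable
  have htop : Tendsto (margF P X j) atTop (nhds 1) := by
    rw [margF_eq_cdf P X hmeas]; exact ProbabilityTheory.tendsto_cdf_atTop _
  obtain ⟨b, hb⟩ := (htop.eventually (lt_mem_nhds h1)).exists
  rcases Set.eq_empty_or_nonempty {x | margF P X j x ≤ s} with he | hne
  · have : {ω | Uv P X 0 ω j ≤ s} = ∅ := by
      ext ω
      simpa [Uv] using (Set.eq_empty_iff_forall_notMem.1 he) (X 0 ω j)
    simpa [this] using hs
  · have hbdd : BddAbove {x | margF P X j x ≤ s} := ⟨b, fun x hx => by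
      by_contra! hlt
      exact absurd (margF_mono P X j hlt.le) (not_le.2 (lt_of_le_of_lt hx hb))⟩
    have hcl : IsClosed {x | margF P X j x ≤ s} := isClosed_le hc continuous_const
    have hmem := hcl.csSup_mem hne hbdd
    refine le_trans ?_ hmem
    exact ENNReal.toReal_mono (measure_ne_top _ _)
      (measure_mono fun ω hω => le_csSup hbdd (show X 0 ω j ∈ _ from hω))

/-- `F(X)` is stochastically at most as large as a uniform variable. -/
theorem le_measure_Uv_le [IsProbabilityMeasure P] (hmeas : Measurable (X 0)) (j : Fin d)
    (hc : Continuous (margF P X j))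
    {v : ℝ} (hv : v < 1) : v ≤ (P {ω | Uv P X 0 ω j ≤ v}).toReal := by
  rcases le_or_gt v 0 with h0 | h0
  · exact h0.trans ENNReal.toReal_nonneg
  have hm : Measurable fun ω => X 0 ω j := (measurable_pi_apply j).comp hmeas
  have := Measure.isProbabilityMeasure_map (μ := P) hm.aemeasurable
  have htop : Tendsto (margF P X j) atTop (nhds 1) := by
    rw [margF_eq_cdf P X hmeas]; exact ProbabilityTheory.tendsto_cdf_atTop _
  have hbot : Tendsto (margF P X j) atBot (nhds 0) := by
    rw [margF_eq_cdf P X hmeas]; exact ProbabilityTheory.tendsto_cdf_atBot _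
  obtain ⟨a, ha⟩ := (hbot.eventually (gt_mem_nhds h0)).exists
  obtain ⟨b, hb⟩ := (htop.eventually (lt_mem_nhds hv)).exists
  obtain ⟨x, hx⟩ := mem_range_of_exists_le_of_exists_ge hc ⟨a, ha.le⟩ ⟨b, hb.le⟩
  have hx' : (P {ω | X 0 ω j ≤ x}).toReal = v := hx
  rw [← hx']
  refine ENNReal.toReal_mono (measure_ne_top _ _) (measure_mono fun ω hω => ?_)
  exact (margF_mono P X j hω).trans (hx.trans hx'.symm).le

theorem ae_Uv_pos [IsProbabilityMeasure P] (hmeas : ∀ i, Measurable (X i))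
    (hstat : StrictlyStationary P X)
    (hcont : ∀ j, Continuous (margF P X j)) : ∀ᵐ ω ∂P, ∀ i j, 0 < Uv P X i ω j := by
  rw [ae_all_iff]; intro i
  rw [ae_all_iff]; intro j
  have h0 : P {ω | Uv P X 0 ω j ≤ 0} = 0 := by
    have := measure_Uv_le_le P X (hmeas 0) j (hcont j) le_rfl
    have h' := le_antisymm this ENNReal.toReal_nonneg
    exact (ENNReal.toReal_eq_zero_iff _).1 h' |>.resolve_right (measure_ne_top _ _)
  have hs := hstat 1 (fun _ => 0) i
  let S : Set (Fin 1 → Fin d → ℝ) := {f | margF P X j (f 0 j) ≤ 0}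
  have hS : MeasurableSet S :=
    measurableSet_le ((hcont j).measurable.comp
      ((measurable_pi_apply j).comp (measurable_pi_apply (0 : Fin 1)))) measurable_const
  have hs' := congrArg (fun m => m S) hs
  rw [Measure.map_apply (measurable_pi_lambda _ fun _ => hmeas _) hS,
    Measure.map_apply (measurable_pi_lambda _ fun _ => hmeas _) hS, zero_add] at hs'
  rw [ae_iff]
  simp only [not_lt]
  exact hs'.trans h0

end Marginal

section Deterministic

variable (P : Measure Ω) (X : ℤ → Ω → Fin d → ℝ)

theorem mul_Gnj {n : ℕ} (hn : 0 < n) (j : Fin d) (s : ℝ) (ω : Ω) :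
    (n : ℝ) * Gnj P X n j s ω =
      ∑ i ∈ Finset.Icc (1 : ℤ) n, indic {ω' | Uv P X i ω' j ≤ s} ω := by
  have : (n : ℝ) ≠ 0 := by positivity
  rw [Gnj, mul_inv_cancel_left₀ this]

theorem mul_empCdfX {Ω : Type*} (X : ℤ → Ω → Fin d → ℝ) {n : ℕ} (hn : 0 < n) (j : Fin d) (x : ℝ)
    (ω : Ω) :
    (n : ℝ) * empCdfX X n j x ω =
      ∑ i ∈ Finset.Icc (1 : ℤ) n, indic {ω' | X i ω' j ≤ x} ω := by
  have : (n : ℝ) ≠ 0 := by positivity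
  rw [empCdfX, mul_inv_cancel_left₀ this]

theorem pseudoObs_le_iff {Ω : Type*} (X : ℤ → Ω → Fin d → ℝ) {n : ℕ} {i : ℤ} {ω : Ω} {j : Fin d}
    {u : ℝ} :
    pseudoObs X n i ω j ≤ u ↔ (n : ℝ) * empCdfX X n j (X i ω j) ω ≤ (n + 1) * u := by
  have : (0 : ℝ) < n + 1 := by positivity
  rw [pseudoObs, div_mul_eq_mul_div, div_le_iff₀ this, mul_comm u]

theorem empCdfX_le_Gnj [IsProbabilityMeasure P] (n : ℕ) (i : ℤ) (j : Fin d) (ω : Ω) :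
    empCdfX X n j (X i ω j) ω ≤ Gnj P X n j (Uv P X i ω j) ω := by
  classical
  unfold empCdfX Gnj
  gcongr with k
  simp only [indic_setOf]
  split_ifs with h1 h2
  · exact le_rfl
  · exact absurd (margF_mono P X j h1) h2
  · exact zero_le_one
  · exact le_rfl

theorem mul_Gnj_add_one_le [IsProbabilityMeasure P] {n : ℕ} (hn : 0 < n) {i : ℤ}
    (hi : i ∈ Finset.Icc (1 : ℤ) n)
    {j : Fin d} {x : ℝ} {ω : Ω} (hx : x < Uv P X i ω j) :
    (n : ℝ) * Gnj P X n j x ω + 1 ≤ n * empCdfX X n j (X i ω j) ω := by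
  classical
  rw [mul_Gnj P X hn, mul_empCdfX X hn]
  have h1 : (1 : ℝ) = ∑ k ∈ Finset.Icc (1 : ℤ) n, if k = i then 1 else 0 := by
    rw [Finset.sum_ite_eq', if_pos hi]
  rw [h1, ← Finset.sum_add_distrib]
  refine Finset.sum_le_sum fun k _ => ?_
  simp only [indic_setOf]
  by_cases hk : k = i
  · subst hk
    simp [not_le.2 hx]
  · rw [if_neg hk, add_zero]
    split_ifs with h2 h3
    · exact le_rfl
    · exact absurd (margF_mono P X j (not_le.1 h3).le) (not_le.2 (h2.trans_lt hx))
    · exact zero_le_one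
    · exact le_rfl

theorem Gnj_nonneg (n : ℕ) (j : Fin d) (x : ℝ) (ω : Ω) : 0 ≤ Gnj P X n j x ω := by
  classical
  unfold Gnj
  refine mul_nonneg (by positivity) (Finset.sum_nonneg fun i _ => ?_)
  rw [indic_setOf]; split_ifs <;> norm_num

theorem mul_empCdfX_le {Ω : Type*} (X : ℤ → Ω → Fin d → ℝ) {n : ℕ} (hn : 0 < n) (j : Fin d)
    (x : ℝ) (ω : Ω) :
    (n : ℝ) * empCdfX X n j x ω ≤ n := by
  classical
  rw [mul_empCdfX X hn]
  refine (Finset.sum_le_card_nsmul _ _ 1 fun i _ => ?_).trans (by simp)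
  rw [indic_setOf]; split_ifs <;> norm_num

theorem Gnj_mono (n : ℕ) (j : Fin d) (ω : Ω) : Monotone fun x => Gnj P X n j x ω := by
  classical
  intro x y hxy
  simp only [Gnj]
  gcongr with k
  simp only [indic_setOf]
  split_ifs with h1 h2
  · exact le_rfl
  · exact absurd (h1.trans hxy) h2
  · exact zero_le_one
  · exact le_rfl

theorem Gnj_of_neg (n : ℕ) (j : Fin d) (ω : Ω) {x : ℝ} (hx : x < 0) : Gnj P X n j x ω = 0 := by
  classical
  have h : ∀ i, ¬ Uv P X i ω j ≤ x := fun i => not_le.2 (hx.trans_le (Uv_nonneg P X i ω j))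
  simp [Gnj, indic_setOf, h]

theorem Gnj_one [IsProbabilityMeasure P] {n : ℕ} (hn : 0 < n) (j : Fin d)
    (ω : Ω) : Gnj P X n j 1 ω = 1 := by
  classical
  have : (n : ℝ) ≠ 0 := by positivity
  have h : ∀ i, Uv P X i ω j ≤ 1 := fun i => Uv_le_one P X i ω j
  simp only [Gnj, indic_setOf, h, if_true]
  simp [this]

/-- The two empirical copula indicators can only disagree in coordinate `j` for observations
sitting exactly at the marginal empirical quantile. -/
theorem Uv_eq_genInv_of_not_iff [IsProbabilityMeasure P] {n : ℕ} (hn : 0 < n) {i : ℤ}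
    (hi : i ∈ Finset.Icc (1 : ℤ) n)
    {j : Fin d} {u : ℝ} (hu0 : 0 ≤ u) (hu1 : u ≤ 1) {ω : Ω}
    (h : ¬(pseudoObs X n i ω j ≤ u ↔ Uv P X i ω j ≤ genInv (fun x => Gnj P X n j x ω) u)) :
    Uv P X i ω j = genInv (fun x => Gnj P X n j x ω) u := by
  have hn' : (0 : ℝ) < n := by positivity
  rw [pseudoObs_le_iff] at h
  have hone : 1 ≤ (n : ℝ) * empCdfX X n j (X i ω j) ω := by
    have h1 := mul_Gnj_add_one_le P X hn hi (sub_one_lt (Uv P X i ω j))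
    have h2 := mul_nonneg hn'.le (Gnj_nonneg P X n j (Uv P X i ω j - 1) ω)
    linarith
  have hle : (n : ℝ) * empCdfX X n j (X i ω j) ω ≤ n * Gnj P X n j (Uv P X i ω j) ω :=
    mul_le_mul_of_nonneg_left (empCdfX_le_Gnj P X n i j ω) hn'.le
  rcases hu0.eq_or_lt with rfl | hu
  · have hB : Uv P X i ω j ≤ genInv (fun x => Gnj P X n j x ω) 0 := by
      by_contra hB
      exact h ⟨fun hA => by linarith, fun hB' => absurd hB' hB⟩
    refine le_antisymm hB ?_
    rw [genInv, if_pos rfl]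
    refine csSup_le ⟨-1, Gnj_of_neg P X n j ω (by norm_num)⟩ fun x hx => ?_
    by_contra! hlt
    have h1 : Gnj P X n j (Uv P X i ω j) ω ≤ Gnj P X n j x ω := Gnj_mono P X n j ω hlt.le
    have h2 : Gnj P X n j x ω = 0 := hx
    have h3 := mul_le_mul_of_nonneg_left h1 hn'.le
    rw [h2] at h3
    linarith
  · have hbdd : BddBelow {x | u ≤ Gnj P X n j x ω} := ⟨0, fun x hx => by
      by_contra! hlt
      have hx' : u ≤ Gnj P X n j x ω := hx
      rw [Gnj_of_neg P X n j ω hlt] at hx'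
      linarith⟩
    have hne : {x | u ≤ Gnj P X n j x ω}.Nonempty := ⟨1, by
      simpa only [mem_ofPred_eq, Gnj_one P X hn] using hu1⟩
    have hq : genInv (fun x => Gnj P X n j x ω) u = sInf {x | u ≤ Gnj P X n j x ω} := by
      rw [genInv, if_neg hu.ne']
    by_cases hB : Uv P X i ω j ≤ genInv (fun x => Gnj P X n j x ω) u
    · have hA : ¬ (n : ℝ) * empCdfX X n j (X i ω j) ω ≤ (n + 1) * u := fun hA =>
        h ⟨fun _ => hB, fun _ => hA⟩
      refine le_antisymm hB ?_
      rw [hq]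
      refine csInf_le hbdd (show u ≤ _ from ?_)
      refine le_of_mul_le_mul_left ?_ hn'
      push Not at hA
      linarith
    · have hA : (n : ℝ) * empCdfX X n j (X i ω j) ω ≤ (n + 1) * u := by
        by_contra hA
        exact h ⟨fun hA' => absurd hA' hA, fun hB' => absurd hB' hB⟩
      rw [hq, not_le] at hB
      obtain ⟨x, hx, hlt⟩ := exists_lt_of_csInf_lt hne hB
      have h1 := mul_Gnj_add_one_le P X hn hi hlt
      have h2 : (n : ℝ) * u ≤ n * Gnj P X n j x ω := mul_le_mul_of_nonneg_left hx hn'.le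
      have h3 := mul_empCdfX_le X hn j (X i ω j) ω
      have h4 : u = 1 := by linarith
      subst h4
      linarith

theorem abs_empCop_sub_copGI_le [IsProbabilityMeasure P] {n : ℕ} (hn : 0 < n) {u : Fin d → ℝ}
    (hu : u ∈ Set.Icc (0 : Fin d → ℝ) 1) (ω : Ω) :
    |empCop X n u ω - copGI P X n u ω| ≤
      ∑ j, (n : ℝ)⁻¹ * ∑ i ∈ Finset.Icc (1 : ℤ) n,
        indic {ω' | Uv P X i ω' j = genInv (fun x => Gnj P X n j x ω) (u j)} ω := by
  rw [empCop, copGI, Gn, ← mul_sub, ← Finset.sum_sub_distrib, abs_mul,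
    abs_of_nonneg (show (0 : ℝ) ≤ (n : ℝ)⁻¹ by positivity), ← Finset.mul_sum, Finset.sum_comm]
  gcongr
  refine (Finset.abs_sum_le_sum_abs _ _).trans (Finset.sum_le_sum fun i hi => ?_)
  exact abs_indic_forall_sub_indic_forall_le
    (p := fun j ω' => pseudoObs X n i ω' j ≤ u j)
    (q := fun j ω' => Uv P X i ω' j ≤ genInv (fun x => Gnj P X n j x ω) (u j))
    (r := fun j ω' => Uv P X i ω' j = genInv (fun x => Gnj P X n j x ω) (u j))
    fun j h => Uv_eq_genInv_of_not_iff P X hn hi (hu.1 j) (hu.2 j) h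

theorem Gn_mem_Icc {n : ℕ} (hn : 0 < n) (u : Fin d → ℝ) (ω : Ω) :
    Gn P X n u ω ∈ Set.Icc (0 : ℝ) 1 := by
  classical
  have hn' : (0 : ℝ) < n := by positivity
  have h : ∀ i, indic {ω' | ∀ j, Uv P X i ω' j ≤ u j} ω ∈ Set.Icc (0 : ℝ) 1 := fun i => by
    rw [indic_setOf]; split_ifs <;> simp
  constructor
  · exact mul_nonneg (by positivity) (Finset.sum_nonneg fun i _ => (h i).1)
  · rw [Gn, inv_mul_le_iff₀ hn', mul_one]
    exact (Finset.sum_le_card_nsmul _ _ 1 fun i _ => (h i).2).trans (by simp)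

theorem abs_alphan_le [IsProbabilityMeasure P] {n : ℕ} (hn : 0 < n) (u : Fin d → ℝ) (ω : Ω) :
    |alphan P X n u ω| ≤ √n := by
  have h1 := Gn_mem_Icc P X hn u ω
  have h2 : 0 ≤ cop P X u := ENNReal.toReal_nonneg
  have h3 : cop P X u ≤ 1 := measureReal_le_one
  rw [alphan, abs_mul, abs_of_nonneg (Real.sqrt_nonneg _)]
  refine mul_le_of_le_one_right (Real.sqrt_nonneg _) (abs_le.2 ⟨?_, ?_⟩) <;>
    linarith [h1.1, h1.2]

theorem Mn_nonneg (n : ℕ) (δ μ : ℝ) (ω : Ω) : 0 ≤ Mn P X n δ μ ω :=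
  Real.iSup_nonneg fun _ => Real.iSup_nonneg fun _ =>
    div_nonneg (abs_nonneg _) (le_max_of_le_right (by positivity))

theorem div_le_Mn [IsProbabilityMeasure P] {n : ℕ} (hn : 0 < n) {δ μ : ℝ} {u v : Fin d → ℝ} (ω : Ω)
    (hu : u ∈ Set.Icc (0 : Fin d → ℝ) 1) (hv : v ∈ Set.Icc (0 : Fin d → ℝ) 1)
    (huv : dist u v ≤ δ) :
    |alphan P X n u ω - alphan P X n v ω| / max (dist u v ^ μ) ((n : ℝ) ^ (-μ)) ≤
      Mn P X n δ μ ω := by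
  have hn' : (0 : ℝ) < n := by positivity
  have hpos : 0 < (n : ℝ) ^ (-μ) := by positivity
  let f : (Fin d → ℝ) × (Fin d → ℝ) → ℝ := fun q =>
    |alphan P X n q.1 ω - alphan P X n q.2 ω| / max (dist q.1 q.2 ^ μ) ((n : ℝ) ^ (-μ))
  let S : Set ((Fin d → ℝ) × (Fin d → ℝ)) := {q | q.1 ∈ Set.Icc 0 1 ∧ q.2 ∈ Set.Icc 0 1 ∧
    dist q.1 q.2 ≤ δ}
  have hf : ∀ q, f q ≤ 2 * √n / (n : ℝ) ^ (-μ) := fun q => by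
    refine div_le_div₀ (by positivity) ?_ hpos (le_max_right _ _)
    have := abs_sub (alphan P X n q.1 ω) (alphan P X n q.2 ω)
    linarith [abs_alphan_le P X hn q.1 ω, abs_alphan_le P X hn q.2 ω]
  have hbdd : BddAbove (Set.range fun q => ⨆ _ : q ∈ S, f q) :=
    ⟨2 * √n / (n : ℝ) ^ (-μ), by
      rintro _ ⟨q, rfl⟩
      exact Real.iSup_le (fun _ => hf q) (by positivity)⟩
  have hmem : (u, v) ∈ S := ⟨hu, hv, huv⟩
  have h := le_ciSup hbdd (u, v)
  simp only [hmem, ciSup_pos] at h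
  exact h

/-- The mass the marginal empirical distribution puts on a single point is controlled by the
modulus of continuity of the empirical process. -/
theorem sum_indic_eq_le [IsProbabilityMeasure P] (hmeas : Measurable (X 0))
    (hcont : ∀ j, Continuous (margF P X j))
    {n : ℕ} (hn : 0 < n) {μ : ℝ} (hμ : 0 ≤ μ) {ω : Ω} (hpos : ∀ i j, 0 < Uv P X i ω j)
    (j : Fin d) (s : ℝ) :
    (n : ℝ)⁻¹ * ∑ i ∈ Finset.Icc (1 : ℤ) n, indic {ω' | Uv P X i ω' j = s} ω ≤
      (n : ℝ) ^ (-(1/2 : ℝ) - μ) * Mn P X n (n : ℝ)⁻¹ μ ω + (n : ℝ)⁻¹ := by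
  classical
  have hn' : (0 : ℝ) < n := by positivity
  have hM := Mn_nonneg P X n (n : ℝ)⁻¹ μ ω
  by_cases hex : ∃ i, Uv P X i ω j = s
  swap
  · push Not at hex
    simp only [indic_setOf, hex, if_false, Finset.sum_const_zero, mul_zero]
    positivity
  obtain ⟨i₀, rfl⟩ := hex
  set s := Uv P X i₀ ω j
  have hs0 : 0 < s := hpos i₀ j
  have hs1 : s ≤ 1 := Uv_le_one P X i₀ ω j
  set v := max (s - (n : ℝ)⁻¹) 0
  have hvs : v < s := max_lt (sub_lt_self _ (by positivity)) hs0
  have hv0 : 0 ≤ v := le_max_right _ _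
  have hsv : s - v ≤ (n : ℝ)⁻¹ := by
    linarith [le_max_left (s - (n : ℝ)⁻¹) 0]
  let e : ℝ → Fin d → ℝ := fun t => Function.update 1 j t
  have he : ∀ t, 0 ≤ t → t ≤ 1 → e t ∈ Set.Icc (0 : Fin d → ℝ) 1 := fun t h0 h1 => by
    constructor <;> intro k <;> by_cases hk : k = j
    · subst hk; simpa [e] using h0
    · simp [e, hk]
    · subst hk; simpa [e] using h1
    · simp [e, hk]
  have hUe : ∀ t i ω', (∀ k, Uv P X i ω' k ≤ e t k) ↔ Uv P X i ω' j ≤ t := fun t i ω' => by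
    constructor
    · intro h; simpa [e] using h j
    · intro h k
      by_cases hk : k = j
      · subst hk; simpa [e] using h
      · simpa [e, hk] using Uv_le_one P X i ω' k
  have hcop : ∀ t, cop P X (e t) = (P {ω | Uv P X 0 ω j ≤ t}).toReal := fun t => by
    simp only [cop, hUe]
  have hC : cop P X (e s) - cop P X (e v) ≤ (n : ℝ)⁻¹ := by
    have h1 := measure_Uv_le_le P X hmeas j (hcont j) hs0.le
    have h2 := le_measure_Uv_le P X hmeas j (hcont j) (hvs.trans_le hs1)
    rw [hcop, hcop]
    linarith
  have hdist : dist (e s) (e v) ≤ (n : ℝ)⁻¹ := by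
    refine (dist_pi_le_iff (by positivity)).2 fun k => ?_
    by_cases hk : k = j
    · subst hk
      simpa [e, Real.dist_eq, abs_of_pos (sub_pos.2 hvs)] using hsv
    · simp [e, hk]
  have hα := div_le_Mn P X hn (μ := μ) ω (he s hs0.le hs1) (he v hv0 (hvs.le.trans hs1)) hdist
  have hmax : max (dist (e s) (e v) ^ μ) ((n : ℝ) ^ (-μ)) = (n : ℝ) ^ (-μ) := by
    refine max_eq_right ?_
    rw [Real.rpow_neg hn'.le, ← Real.inv_rpow hn'.le]
    exact Real.rpow_le_rpow dist_nonneg hdist hμ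
  rw [hmax, div_le_iff₀ (by positivity)] at hα
  have hG : (n : ℝ)⁻¹ * ∑ i ∈ Finset.Icc (1 : ℤ) n, indic {ω' | Uv P X i ω' j = s} ω ≤
      Gn P X n (e s) ω - Gn P X n (e v) ω := by
    rw [Gn, Gn, ← mul_sub, ← Finset.sum_sub_distrib]
    gcongr with i
    simp only [hUe, indic_setOf]
    rcases lt_trichotomy (Uv P X i ω j) s with h | h | h
    · simp only [h.ne, h.le, if_false, if_true]
      split_ifs <;> norm_num
    · simp [h, not_le.2 hvs]
    · simp [h.ne', not_le.2 h, not_le.2 (hvs.trans h)]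
  have hsqrt : (0 : ℝ) < √n := Real.sqrt_pos.2 hn'
  have hGα : Gn P X n (e s) ω - Gn P X n (e v) ω =
      (√n)⁻¹ * (alphan P X n (e s) ω - alphan P X n (e v) ω) +
        (cop P X (e s) - cop P X (e v)) := by
    simp only [alphan]
    field_simp
    ring
  have hr : (n : ℝ) ^ (-(1/2 : ℝ) - μ) = (√n)⁻¹ * (n : ℝ) ^ (-μ) := by
    rw [sub_eq_add_neg, Real.rpow_add hn', Real.rpow_neg hn'.le, Real.sqrt_eq_rpow]
  have hstep : (√n)⁻¹ * (alphan P X n (e s) ω - alphan P X n (e v) ω) ≤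
      (√n)⁻¹ * (Mn P X n (n : ℝ)⁻¹ μ ω * (n : ℝ) ^ (-μ)) :=
    mul_le_mul_of_nonneg_left ((le_abs_self _).trans hα) (by positivity)
  rw [hr]
  linarith

theorem iSup_abs_empCop_sub_copGI_le [IsProbabilityMeasure P] (hmeas : Measurable (X 0))
    (hcont : ∀ j, Continuous (margF P X j)) {n : ℕ} (hn : 0 < n) {μ : ℝ} (hμ : 0 ≤ μ) {ω : Ω}
    (hpos : ∀ i j, 0 < Uv P X i ω j) :
    (⨆ u ∈ Set.Icc (0 : Fin d → ℝ) 1, |empCop X n u ω - copGI P X n u ω|) ≤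
      d * ((n : ℝ) ^ (-(1/2 : ℝ) - μ) * Mn P X n (n : ℝ)⁻¹ μ ω + (n : ℝ)⁻¹) := by
  have hM := Mn_nonneg P X n (n : ℝ)⁻¹ μ ω
  have h0 : 0 ≤ d * ((n : ℝ) ^ (-(1/2 : ℝ) - μ) * Mn P X n (n : ℝ)⁻¹ μ ω + (n : ℝ)⁻¹) := by
    positivity
  refine Real.iSup_le (fun u => Real.iSup_le (fun hu => ?_) h0) h0
  refine (abs_empCop_sub_copGI_le P X hn hu ω).trans ?_
  refine (Finset.sum_le_card_nsmul _ _ _ fun j _ =>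
    sum_indic_eq_le P X hmeas hcont hn hμ hpos j _).trans_eq ?_
  rw [Finset.card_univ, Fintype.card_fin, nsmul_eq_mul]

end Deterministic

/-- First step of the proof of Lemma 4.6: uniform closeness of the empirical copula
`Ĉ_n` and its generalized-inverse version `C_n` at rate `o_P(n^{−1/2−μ})`. -/
theorem empCop_copGI_close
    {Ω : Type*} [MeasurableSpace Ω] {d : ℕ} (hd : 2 ≤ d)
    (P : Measure Ω) [IsProbabilityMeasure P] (X : ℤ → Ω → Fin d → ℝ)
    (hmeas : ∀ i, Measurable (X i)) (hstat : StrictlyStationary P X)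
    (hcont : ∀ j, Continuous (margF P X j))
    (θ₁ : ℝ) (hθ₁ : θ₁ ∈ Set.Ioc (0 : ℝ) (1/2)) (h41 : Condition41 P X θ₁) :
    ∀ μ ∈ Set.Ioo (0 : ℝ) θ₁,
      oP P (fun n ω => ⨆ u ∈ Set.Icc (0 : Fin d → ℝ) 1, |empCop X n u ω - copGI P X n u ω|)
        (fun n => (n : ℝ) ^ (-(1/2 : ℝ) - μ)) := by
  intro μ hμ ε hε
  have hd0 : (0 : ℝ) < d := by exact_mod_cast (by omega : 0 < d)
  have hM := h41 μ hμ (fun n => (n : ℝ)⁻¹) tendsto_inv_atTop_nhds_zero_nat (ε / (2 * d))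
    (by positivity)
  have hμ2 : 0 < 1/2 - μ := by linarith [hμ.2, hθ₁.2]
  have hlim : Tendsto (fun n : ℕ => (n : ℝ) ^ (-(1/2 - μ))) atTop (nhds 0) :=
    (tendsto_rpow_neg_atTop hμ2).comp tendsto_natCast_atTop_atTop
  have hsmall : ∀ᶠ n : ℕ in atTop, (n : ℝ) ^ (-(1/2 - μ)) < ε / (2 * d) :=
    hlim.eventually (gt_mem_nhds (by positivity))
  refine tendsto_of_tendsto_of_tendsto_of_le_of_le' tendsto_const_nhds hM
    (Eventually.of_forall fun _ => zero_le) ?_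
  filter_upwards [hsmall, eventually_gt_atTop 0] with n hns hn
  have hn' : (0 : ℝ) < n := by positivity
  refine measure_mono_ae ?_
  filter_upwards [ae_Uv_pos P X hmeas hstat hcont] with ω hpos hω
  replace hω : ε * (n : ℝ) ^ (-(1/2 : ℝ) - μ) <
    |(⨆ u ∈ Set.Icc (0 : Fin d → ℝ) 1, |empCop X n u ω - copGI P X n u ω|)| := hω
  rw [abs_of_nonneg (Real.iSup_nonneg fun _ => Real.iSup_nonneg fun _ => abs_nonneg _)] at hω
  have hle := iSup_abs_empCop_sub_copGI_le P X (hmeas 0) hcont hn hμ.1.le hpos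
  have hr : 0 < (n : ℝ) ^ (-(1/2 : ℝ) - μ) := by positivity
  have hinv : (n : ℝ)⁻¹ = (n : ℝ) ^ (-(1/2 : ℝ) - μ) * (n : ℝ) ^ (-(1/2 - μ)) := by
    rw [← Real.rpow_add hn', ← Real.rpow_neg_one]
    congr 1
    ring
  have hε2 : ε = d * (ε / (2 * d) + ε / (2 * d)) := by
    field_simp
    ring
  have hlt := hω.trans_le hle
  show ε / (2 * d) * 1 < |Mn P X n (n : ℝ)⁻¹ μ ω|
  rw [abs_of_nonneg (Mn_nonneg P X n _ μ ω), mul_one]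
  by_contra! hcon
  have h1 : Mn P X n (n : ℝ)⁻¹ μ ω + (n : ℝ) ^ (-(1/2 - μ)) ≤ ε / (2 * d) + ε / (2 * d) :=
    add_le_add hcon hns.le
  have h2 := mul_le_mul_of_nonneg_left h1 (mul_nonneg hd0.le hr.le)
  have h3 : (d : ℝ) * ((n : ℝ) ^ (-(1/2 : ℝ) - μ) * Mn P X n (n : ℝ)⁻¹ μ ω + (n : ℝ)⁻¹) =
      d * (n : ℝ) ^ (-(1/2 : ℝ) - μ) *
        (Mn P X n (n : ℝ)⁻¹ μ ω + (n : ℝ) ^ (-(1/2 - μ))) := by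
    nth_rewrite 2 [hinv]
    ring
  have h4 : (d : ℝ) * (n : ℝ) ^ (-(1/2 : ℝ) - μ) * (ε / (2 * d) + ε / (2 * d)) =
      ε * (n : ℝ) ^ (-(1/2 : ℝ) - μ) := by
    field_simp
    ring
  linarith

end BBV
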